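/- (Splitting of (2,2)-forms) Let V be 4-dimensional with nondegenerate induced boundary metric, e: R³→V injective, ε_n completing to a basis. For every β ∈ Λ²(R³)*⊗Λ²V there exist a unique v ∈ Ker(W_1^{∂(1,2)}) ⊂ Λ¹(R³)*⊗Λ²V (i.e. e∧v = 0) and a unique ρ ∈ Λ¹(R³)*⊗V such that β = e∧ρ + ε_n∧[e, v], where [e,v] ∈ Λ²(R³)*⊗Λ¹V is the contraction of v's Λ²V factor with e's V factor via the metric η. -/

import Mathlib

noncomputable section

/-- The (pointwise) total exterior algebra `Λ•((ℝ³)* ⊕ V)`, inside which all the spaces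
`Ω_∂^{(k,l)} = Λ^k(ℝ³)* ⊗ Λ^l V` are realised (the boundary cotangent factor being
modelled by the 3-dimensional space `ℝ³`). -/
abbrev BExt (V : Type*) [AddCommGroup V] [Module ℝ V] : Type _ :=
  ExteriorAlgebra ℝ ((Fin 3 → ℝ) × V)

/-- The inclusion of a boundary covector into `BExt V`. -/
def ιW (V : Type*) [AddCommGroup V] [Module ℝ V] (w : Fin 3 → ℝ) : BExt V :=
  ExteriorAlgebra.ι ℝ (w, 0)

/-- The inclusion of a vector of `V` into `BExt V`. -/
def ιV {V : Type*} [AddCommGroup V] [Module ℝ V] (v : V) : BExt V :=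
  ExteriorAlgebra.ι ℝ ((0 : Fin 3 → ℝ), v)

/-- The subspace `Ω_∂^{(k,l)} = Λ^k(ℝ³)* ⊗ Λ^l V` of `BExt V`. -/
def Omeg (V : Type*) [AddCommGroup V] [Module ℝ V] (k l : ℕ) : Submodule ℝ (BExt V) :=
  (LinearMap.range ((ExteriorAlgebra.ι ℝ).comp (LinearMap.inl ℝ (Fin 3 → ℝ) V))) ^ k *
    (LinearMap.range ((ExteriorAlgebra.ι ℝ).comp (LinearMap.inr ℝ (Fin 3 → ℝ) V))) ^ l

/-- The boundary coframe `e ∈ Ω_∂^{(1,1)}` associated to an injective linear map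
`e : ℝ³ → V`. -/
def Eelt {V : Type*} [AddCommGroup V] [Module ℝ V] (e : (Fin 3 → ℝ) →ₗ[ℝ] V) : BExt V :=
  ∑ i : Fin 3, ιW V (Pi.single i 1) * ιV (e (Pi.single i 1))

/-- Contraction of `BExt V` with a dual vector, as an odd derivation. -/
def contrD {V : Type*} [AddCommGroup V] [Module ℝ V]
    (φ : Module.Dual ℝ ((Fin 3 → ℝ) × V)) : BExt V →ₗ[ℝ] BExt V :=
  CliffordAlgebra.contractLeft (Q := (0 : QuadraticForm ℝ ((Fin 3 → ℝ) × V))) φ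

/-- The operation `[e, ·]`: the `η`-contraction of the `Λ•V` factor with the `V` factor
of the coframe `e`, wedged with the `(ℝ³)*` factor of `e`. -/
def brE {V : Type*} [AddCommGroup V] [Module ℝ V]
    (η : V →ₗ[ℝ] V →ₗ[ℝ] ℝ) (e : (Fin 3 → ℝ) →ₗ[ℝ] V) (x : BExt V) : BExt V :=
  ∑ i : Fin 3, ιW V (Pi.single i 1) *
    contrD ((η (e (Pi.single i 1))).comp (LinearMap.snd ℝ (Fin 3 → ℝ) V)) x

/-- `x_{c+1} x_{c+2}` for three generators. -/
def dualPair {A : Type*} [Mul A] (a b c : A) : Fin 3 → A := ![b * c, c * a, a * b]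

def mk11 {A : Type*} [Ring A] [Algebra ℝ A] (x : Fin 7 → A) (R : Fin 3 → Fin 3 → ℝ)
    (r : Fin 3 → ℝ) : A :=
  (∑ i, ∑ b, R i b • (![x 0, x 1, x 2] i * ![x 4, x 5, x 6] b)) +
    ∑ i, r i • (![x 0, x 1, x 2] i * x 3)

def mk12 {A : Type*} [Ring A] [Algebra ℝ A] (x : Fin 7 → A) (S U : Fin 3 → Fin 3 → ℝ) : A :=
  (∑ i, ∑ b, S i b • (![x 0, x 1, x 2] i * dualPair (x 4) (x 5) (x 6) b)) +
    ∑ i, ∑ b, U i b • (![x 0, x 1, x 2] i * (x 3 * ![x 4, x 5, x 6] b))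

def mk22 {A : Type*} [Ring A] [Algebra ℝ A] (x : Fin 7 → A) (P Q : Fin 3 → Fin 3 → ℝ) : A :=
  (∑ c, ∑ d, P c d • (dualPair (x 0) (x 1) (x 2) c * dualPair (x 4) (x 5) (x 6) d)) +
    ∑ c, ∑ d, Q c d • (dualPair (x 0) (x 1) (x 2) c * (x 3 * ![x 4, x 5, x 6] d))

def mk23 {A : Type*} [Ring A] [Algebra ℝ A] (x : Fin 7 → A) (X : Fin 3 → ℝ)
    (Y : Fin 3 → Fin 3 → ℝ) : A :=
  (∑ c, X c • (dualPair (x 0) (x 1) (x 2) c * (x 4 * (x 5 * x 6)))) +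
    ∑ c, ∑ d, Y c d • (dualPair (x 0) (x 1) (x 2) c * (x 3 * dualPair (x 4) (x 5) (x 6) d))

def trc (R : Fin 3 → Fin 3 → ℝ) : ℝ := R 0 0 + R 1 1 + R 2 2

/-- `tr R δ - Rᵀ` -/
def cofOne (R : Fin 3 → Fin 3 → ℝ) : Fin 3 → Fin 3 → ℝ :=
  fun c d => (if c = d then trc R else 0) - R d c

/-- the antisymmetric matrix of a vector -/
def skewM (r : Fin 3 → ℝ) : Fin 3 → Fin 3 → ℝ :=
  ![![0, r 2, - r 1], ![- r 2, 0, r 0], ![r 1, - r 0, 0]]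

/-- the polarised cofactor matrix -/
def mixCof (g S : Fin 3 → Fin 3 → ℝ) : Fin 3 → Fin 3 → ℝ := fun c d =>
  g (c+1) (d+1) * S (c+2) (d+2) + g (c+2) (d+2) * S (c+1) (d+1)
    - g (c+1) (d+2) * S (c+2) (d+1) - g (c+2) (d+1) * S (c+1) (d+2)

section alg
variable {A : Type*} [Ring A] (x : Fin 7 → A)

def Anti : Prop := (∀ i j, x i * x j = - (x j * x i)) ∧ ∀ i, x i * x i = 0

variable {x}

theorem Anti.swap (h : Anti x) (i j : Fin 7) (_ : j < i) : x i * x j = - (x j * x i) := h.1 i j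
theorem Anti.swap' (h : Anti x) (i j : Fin 7) (t : A) (_ : j < i) :
    x i * (x j * t) = - (x j * (x i * t)) := by
  rw [← mul_assoc, h.1 i j, neg_mul, mul_assoc]
theorem Anti.sq' (h : Anti x) (i : Fin 7) (t : A) : x i * (x i * t) = 0 := by
  rw [← mul_assoc, h.2 i, zero_mul]

variable [Algebra ℝ A]

def eel (x : Fin 7 → A) : A := x 0 * x 4 + x 1 * x 5 + x 2 * x 6

theorem eel_mk11 (h : Anti x) (R : Fin 3 → Fin 3 → ℝ) (r : Fin 3 → ℝ) :
    eel x * mk11 x R r = mk22 x (fun c d => - cofOne R c d) (skewM r) := by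
  simp [eel, mk11, mk22, dualPair, cofOne, trc, skewM, Fin.sum_univ_three, mul_add, add_mul, mul_assoc,
    h.swap, h.swap', h.sq', h.2]
  module

theorem eel_mk12 (h : Anti x) (S U : Fin 3 → Fin 3 → ℝ) :
    eel x * mk12 x S U = mk23 x (![S 1 2 - S 2 1, S 2 0 - S 0 2, S 0 1 - S 1 0]) (cofOne U) := by
  simp [eel, mk12, mk23, dualPair, cofOne, trc, Fin.sum_univ_three, mul_add, add_mul, mul_assoc,
    h.swap, h.swap', h.sq', h.2]
  module

end alg

section contr
variable {A : Type*} [Ring A] [Algebra ℝ A] {x : Fin 7 → A}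

/-- `D` is an odd contraction with value `c i` on the generator `x i`. -/
def IsContr (x : Fin 7 → A) (c : Fin 7 → ℝ) (D : A →ₗ[ℝ] A) : Prop :=
  (∀ i t, D (x i * t) = c i • t - x i * D t) ∧ (∀ i, D (x i) = c i • (1 : A)) ∧ D 1 = 0

theorem bracket_mk12 (h : Anti x) (g S : Fin 3 → Fin 3 → ℝ) (c : Fin 3 → Fin 7 → ℝ)
    (D : Fin 3 → A →ₗ[ℝ] A) (hD : ∀ j, IsContr x (c j) (D j))
    (c0 : ∀ j, c j 0 = 0) (c1 : ∀ j, c j 1 = 0) (c2 : ∀ j, c j 2 = 0)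
    (c4 : ∀ j, c j 4 = g j 0) (c5 : ∀ j, c j 5 = g j 1) (c6 : ∀ j, c j 6 = g j 2) :
    x 3 * (x 0 * D 0 (mk12 x S 0) + x 1 * D 1 (mk12 x S 0) + x 2 * D 2 (mk12 x S 0)) =
      mk22 x 0 (mixCof g S) := by
  have e1 : ∀ j i t, D j (x i * t) = c j i • t - x i * D j t := fun j => (hD j).1
  have e2 : ∀ j i, D j (x i) = c j i • (1 : A) := fun j => (hD j).2.1
  simp [mk12, mk22, dualPair, mixCof, Fin.sum_univ_three, mul_add, mul_assoc, mul_sub,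
    h.swap, h.swap', h.sq', e1, e2, c0, c1, c2, c4, c5, c6]
  module

set_option maxHeartbeats 2000000 in
theorem mk22_zero [Nontrivial A] (D : Fin 7 → A →ₗ[ℝ] A)
    (hD : ∀ j, IsContr x (fun i => if i = j then 1 else 0) (D j))
    (P Q : Fin 3 → Fin 3 → ℝ) (h : mk22 x P Q = 0) : (∀ c d, P c d = 0) ∧ ∀ c d, Q c d = 0 := by
  have e1 : ∀ j i t, D j (x i * t) = (if i = j then (1 : ℝ) else 0) • t - x i * D j t :=
    fun j => (hD j).1
  have e2 : ∀ j i, D j (x i) = (if i = j then (1 : ℝ) else 0) • (1 : A) := fun j => (hD j).2.1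
  have e3 : ∀ j, D j 1 = 0 := fun j => (hD j).2.2
  have key : ∀ i j k l, D i (D j (D k (D l (mk22 x P Q)))) = 0 := by
    intro i j k l; rw [h]; simp
  simp only [mk22, dualPair, Fin.sum_univ_three, Matrix.cons_val, mul_assoc, map_add, map_smul, e1, map_sub] at key
  constructor
  · intro c d
    fin_cases c <;> fin_cases d
    · simpa [e1, e2, e3] using key 6 5 2 1
    · simpa [e1, e2, e3] using key 4 6 2 1
    · simpa [e1, e2, e3] using key 5 4 2 1
    · simpa [e1, e2, e3] using key 6 5 0 2
    · simpa [e1, e2, e3] using key 4 6 0 2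
    · simpa [e1, e2, e3] using key 5 4 0 2
    · simpa [e1, e2, e3] using key 6 5 1 0
    · simpa [e1, e2, e3] using key 4 6 1 0
    · simpa [e1, e2, e3] using key 5 4 1 0
  · intro c d
    fin_cases c <;> fin_cases d
    · simpa [e1, e2, e3] using key 4 3 2 1
    · simpa [e1, e2, e3] using key 5 3 2 1
    · simpa [e1, e2, e3] using key 6 3 2 1
    · simpa [e1, e2, e3] using key 4 3 0 2
    · simpa [e1, e2, e3] using key 5 3 0 2
    · simpa [e1, e2, e3] using key 6 3 0 2
    · simpa [e1, e2, e3] using key 4 3 1 0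
    · simpa [e1, e2, e3] using key 5 3 1 0
    · simpa [e1, e2, e3] using key 6 3 1 0

set_option maxHeartbeats 2000000 in
theorem mk23_zero [Nontrivial A] (D : Fin 7 → A →ₗ[ℝ] A)
    (hD : ∀ j, IsContr x (fun i => if i = j then 1 else 0) (D j))
    (X : Fin 3 → ℝ) (Y : Fin 3 → Fin 3 → ℝ) (h : mk23 x X Y = 0) :
    (∀ c, X c = 0) ∧ ∀ c d, Y c d = 0 := by
  have e1 : ∀ j i t, D j (x i * t) = (if i = j then (1 : ℝ) else 0) • t - x i * D j t :=
    fun j => (hD j).1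
  have e2 : ∀ j i, D j (x i) = (if i = j then (1 : ℝ) else 0) • (1 : A) := fun j => (hD j).2.1
  have e3 : ∀ j, D j 1 = 0 := fun j => (hD j).2.2
  have key : ∀ i j k l m, D i (D j (D k (D l (D m (mk23 x X Y))))) = 0 := by
    intro i j k l m; rw [h]; simp
  simp only [mk23, dualPair, Fin.sum_univ_three, Matrix.cons_val, mul_assoc, map_add, map_smul, e1, map_sub] at key
  constructor
  · intro c
    fin_cases c
    · simpa [e1, e2, e3] using key 6 5 4 2 1
    · simpa [e1, e2, e3] using key 6 5 4 0 2
    · simpa [e1, e2, e3] using key 6 5 4 1 0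
  · intro c d
    fin_cases c <;> fin_cases d
    · simpa [e1, e2, e3] using key 6 5 3 2 1
    · simpa [e1, e2, e3] using key 4 6 3 2 1
    · simpa [e1, e2, e3] using key 5 4 3 2 1
    · simpa [e1, e2, e3] using key 6 5 3 0 2
    · simpa [e1, e2, e3] using key 4 6 3 0 2
    · simpa [e1, e2, e3] using key 5 4 3 0 2
    · simpa [e1, e2, e3] using key 6 5 3 1 0
    · simpa [e1, e2, e3] using key 4 6 3 1 0
    · simpa [e1, e2, e3] using key 5 4 3 1 0

theorem mk22_sub (P Q P' Q' : Fin 3 → Fin 3 → ℝ) :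
    mk22 x P Q - mk22 x P' Q' = mk22 x (P - P') (Q - Q') := by
  simp only [mk22, Pi.sub_apply, sub_smul, Finset.sum_sub_distrib]; abel

theorem mk22_add (P Q P' Q' : Fin 3 → Fin 3 → ℝ) :
    mk22 x P Q + mk22 x P' Q' = mk22 x (P + P') (Q + Q') := by
  simp only [mk22, Pi.add_apply, add_smul, Finset.sum_add_distrib]; abel

theorem mk12_add (P Q P' Q' : Fin 3 → Fin 3 → ℝ) :
    mk12 x P Q + mk12 x P' Q' = mk12 x (P + P') (Q + Q') := by
  simp only [mk12, Pi.add_apply, add_smul, Finset.sum_add_distrib]; abel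

theorem mk11_add (P P' : Fin 3 → Fin 3 → ℝ) (Q Q' : Fin 3 → ℝ) :
    mk11 x P Q + mk11 x P' Q' = mk11 x (P + P') (Q + Q') := by
  simp only [mk11, Pi.add_apply, add_smul, Finset.sum_add_distrib]; abel

end contr

/-- determinant of a `3 × 3` array -/
def det3 (g : Fin 3 → Fin 3 → ℝ) : ℝ := Matrix.det (Matrix.of g)

/-- the (unnormalised) inverse of `mixCof g` on symmetric arrays -/
def invCof (g T : Fin 3 → Fin 3 → ℝ) : Fin 3 → Fin 3 → ℝ := fun i j =>
  (1 / 2) * (∑ a, ∑ b, g a b * T a b) * g i j - ∑ a, ∑ b, g i a * T a b * g b j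

theorem mixCof_symm (g S : Fin 3 → Fin 3 → ℝ) (hg : ∀ i j, g i j = g j i)
    (hS : ∀ i j, S i j = S j i) (i j : Fin 3) : mixCof g S i j = mixCof g S j i := by
  simp only [mixCof]
  rw [hg (i+1) (j+1), hg (i+2) (j+2), hg (i+1) (j+2), hg (i+2) (j+1), hS (i+1) (j+1),
    hS (i+2) (j+2), hS (i+1) (j+2), hS (i+2) (j+1)]
  ring

theorem invCof_symm (g S : Fin 3 → Fin 3 → ℝ) (hg : ∀ i j, g i j = g j i)
    (hS : ∀ i j, S i j = S j i) (i j : Fin 3) : invCof g S i j = invCof g S j i := by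
  simp only [invCof, Fin.sum_univ_three]
  rw [hg j i, hg j 0, hg j 1, hg j 2, hg 0 i, hg 1 i, hg 2 i, hS 1 0, hS 2 0, hS 2 1]
  ring

theorem invCof_mixCof (g S : Fin 3 → Fin 3 → ℝ) (hg : ∀ i j, g i j = g j i)
    (hS : ∀ i j, S i j = S j i) (i j : Fin 3) : invCof g (mixCof g S) i j = det3 g * S i j := by
  have a1 := hg 1 0
  have a2 := hg 2 0
  have a3 := hg 2 1
  have b1 := hS 1 0
  have b2 := hS 2 0
  have b3 := hS 2 1
  fin_cases i <;> fin_cases j <;>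
    simp [invCof, mixCof, Fin.sum_univ_three, det3, Matrix.det_fin_three, a1, a2, a3, b1, b2, b3] <;> ring

theorem mixCof_invCof (g T : Fin 3 → Fin 3 → ℝ) (hg : ∀ i j, g i j = g j i)
    (hT : ∀ i j, T i j = T j i) (i j : Fin 3) : mixCof g (invCof g T) i j = det3 g * T i j := by
  have a1 := hg 1 0
  have a2 := hg 2 0
  have a3 := hg 2 1
  have b1 := hT 1 0
  have b2 := hT 2 0
  have b3 := hT 2 1
  fin_cases i <;> fin_cases j <;>
    simp [invCof, mixCof, Fin.sum_univ_three, det3, Matrix.det_fin_three, a1, a2, a3, b1, b2, b3] <;> ring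

section concrete
variable {V : Type*} [AddCommGroup V] [Module ℝ V]

/-- the seven generators -/
def gen (e : (Fin 3 → ℝ) →ₗ[ℝ] V) (εn : V) : Fin 7 → (Fin 3 → ℝ) × V :=
  ![(Pi.single 0 1, 0), (Pi.single 1 1, 0), (Pi.single 2 1, 0), (0, εn),
    (0, e (Pi.single 0 1)), (0, e (Pi.single 1 1)), (0, e (Pi.single 2 1))]

def xg (e : (Fin 3 → ℝ) →ₗ[ℝ] V) (εn : V) (i : Fin 7) : BExt V :=
  ExteriorAlgebra.ι ℝ (gen e εn i)

theorem xg_anti (e : (Fin 3 → ℝ) →ₗ[ℝ] V) (εn : V) : Anti (xg e εn) := by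
  refine ⟨fun i j => ?_, fun i => ExteriorAlgebra.ι_sq_zero _⟩
  exact eq_neg_of_add_eq_zero_left (ExteriorAlgebra.ι_add_mul_swap _ _)

theorem xg_contr (e : (Fin 3 → ℝ) →ₗ[ℝ] V) (εn : V) (φ : Module.Dual ℝ ((Fin 3 → ℝ) × V)) :
    IsContr (xg e εn) (fun i => φ (gen e εn i)) (contrD φ) := by
  refine ⟨fun i t => ?_, fun i => ?_, ?_⟩
  · exact CliffordAlgebra.contractLeft_ι_mul (Q := 0) φ (gen e εn i) t
  · rw [← Algebra.algebraMap_eq_smul_one]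
    exact CliffordAlgebra.contractLeft_ι (Q := 0) φ (gen e εn i)
  · exact CliffordAlgebra.contractLeft_one (Q := 0) φ

theorem Eelt_eq (e : (Fin 3 → ℝ) →ₗ[ℝ] V) (εn : V) : Eelt e = eel (xg e εn) := by
  simp [Eelt, Fin.sum_univ_three, eel, ιW, ιV, xg, gen]

/-- existence of the dual contractions -/
theorem exists_dual (e : (Fin 3 → ℝ) →ₗ[ℝ] V) (εn : V)
    (hindep : LinearIndependent ℝ
      (Fin.snoc (fun i : Fin 3 => e (Pi.single i 1)) εn : Fin 4 → V))
    (hspan : Submodule.span ℝ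
      (Set.range (Fin.snoc (fun i : Fin 3 => e (Pi.single i 1)) εn : Fin 4 → V)) = ⊤) :
    ∃ D : Fin 7 → BExt V →ₗ[ℝ] BExt V,
      ∀ j, IsContr (xg e εn) (fun i => if i = j then 1 else 0) (D j) := by
  let b := Module.Basis.mk hindep hspan.ge
  have hb : ∀ i, b i = (Fin.snoc (fun i : Fin 3 => e (Pi.single i 1)) εn : Fin 4 → V) i :=
    fun i => by simp [b]
  have hb0 : b 0 = e (Pi.single 0 1) := hb 0
  have hb1 : b 1 = e (Pi.single 1 1) := hb 1
  have hb2 : b 2 = e (Pi.single 2 1) := hb 2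
  have hb3 : b 3 = εn := hb 3
  let p : Fin 3 → Module.Dual ℝ ((Fin 3 → ℝ) × V) := fun i =>
    (LinearMap.proj i).comp (LinearMap.fst ℝ (Fin 3 → ℝ) V)
  let q : Fin 4 → Module.Dual ℝ ((Fin 3 → ℝ) × V) := fun i =>
    (b.coord i).comp (LinearMap.snd ℝ (Fin 3 → ℝ) V)
  let φ : Fin 7 → Module.Dual ℝ ((Fin 3 → ℝ) × V) := ![p 0, p 1, p 2, q 3, q 0, q 1, q 2]
  refine ⟨fun j => contrD (φ j), fun j => ?_⟩
  have : (fun i => if i = j then (1 : ℝ) else 0) = fun i => φ j (gen e εn i) := by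
    funext i
    fin_cases i <;> fin_cases j <;>
      simp [φ, p, q, gen, ← hb0, ← hb1, ← hb2, ← hb3, Finsupp.single_apply]
  rw [this]
  exact xg_contr e εn (φ j)

theorem mem_W (e : (Fin 3 → ℝ) →ₗ[ℝ] V) (εn : V) {y : BExt V}
    (hy : y ∈ LinearMap.range
      ((ExteriorAlgebra.ι ℝ).comp (LinearMap.inl ℝ (Fin 3 → ℝ) V))) :
    ∃ a : Fin 3 → ℝ, y = a 0 • xg e εn 0 + a 1 • xg e εn 1 + a 2 • xg e εn 2 := by
  obtain ⟨w, rfl⟩ := hy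
  refine ⟨w, ?_⟩
  have : (LinearMap.inl ℝ (Fin 3 → ℝ) V) w =
      w 0 • gen e εn 0 + w 1 • gen e εn 1 + w 2 • gen e εn 2 := by
    ext i
    · fin_cases i <;> simp [gen]
    · simp [gen]
  rw [LinearMap.comp_apply, this]
  simp [xg]

theorem mem_V (e : (Fin 3 → ℝ) →ₗ[ℝ] V) (εn : V)
    (hspan : Submodule.span ℝ
      (Set.range (Fin.snoc (fun i : Fin 3 => e (Pi.single i 1)) εn : Fin 4 → V)) = ⊤)
    {y : BExt V}
    (hy : y ∈ LinearMap.range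
      ((ExteriorAlgebra.ι ℝ).comp (LinearMap.inr ℝ (Fin 3 → ℝ) V))) :
    ∃ (a : Fin 3 → ℝ) (b : ℝ), y = a 0 • xg e εn 4 + a 1 • xg e εn 5 + a 2 • xg e εn 6
      + b • xg e εn 3 := by
  obtain ⟨v, rfl⟩ := hy
  have hv : v ∈ Submodule.span ℝ
      (Set.range (Fin.snoc (fun i : Fin 3 => e (Pi.single i 1)) εn : Fin 4 → V)) := by
    rw [hspan]; trivial
  obtain ⟨c, hc⟩ := (Submodule.mem_span_range_iff_exists_fun ℝ).1 hv
  rw [Fin.sum_univ_castSucc] at hc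
  simp only [Fin.snoc_castSucc, Fin.snoc_last, Fin.sum_univ_three] at hc
  refine ⟨fun i => c i.castSucc, c (Fin.last 3), ?_⟩
  have : (LinearMap.inr ℝ (Fin 3 → ℝ) V) v =
      c (Fin.castSucc 0) • gen e εn 4 + c (Fin.castSucc 1) • gen e εn 5
        + c (Fin.castSucc 2) • gen e εn 6 + c (Fin.last 3) • gen e εn 3 := by
    rw [← hc]
    ext i
    · simp [gen]
    · simp [gen]
  rw [LinearMap.comp_apply, this]
  simp only [xg, map_add, map_smul]

theorem mem_WW (e : (Fin 3 → ℝ) →ₗ[ℝ] V) (εn : V) {y : BExt V}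
    (hy : y ∈ (LinearMap.range
      ((ExteriorAlgebra.ι ℝ).comp (LinearMap.inl ℝ (Fin 3 → ℝ) V))) ^ 2) :
    ∃ a : Fin 3 → ℝ, y = ∑ c, a c • dualPair (xg e εn 0) (xg e εn 1) (xg e εn 2) c := by
  have h := xg_anti e εn
  rw [pow_two] at hy
  induction hy using Submodule.mul_induction_on' with
  | mem_mul_mem m hm n hn =>
    obtain ⟨a, rfl⟩ := mem_W e εn hm
    obtain ⟨b, rfl⟩ := mem_W e εn hn
    refine ⟨![a 1 * b 2 - a 2 * b 1, a 2 * b 0 - a 0 * b 2, a 0 * b 1 - a 1 * b 0], ?_⟩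
    simp [dualPair, Fin.sum_univ_three, mul_add, add_mul, h.swap, h.2]
    module
  | add x _ y _ hx hy =>
    obtain ⟨a, rfl⟩ := hx
    obtain ⟨b, rfl⟩ := hy
    exact ⟨a + b, by simp [add_smul, Finset.sum_add_distrib]⟩

theorem mem_VV (e : (Fin 3 → ℝ) →ₗ[ℝ] V) (εn : V)
    (hspan : Submodule.span ℝ
      (Set.range (Fin.snoc (fun i : Fin 3 => e (Pi.single i 1)) εn : Fin 4 → V)) = ⊤)
    {y : BExt V}
    (hy : y ∈ (LinearMap.range
      ((ExteriorAlgebra.ι ℝ).comp (LinearMap.inr ℝ (Fin 3 → ℝ) V))) ^ 2) :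
    ∃ a b : Fin 3 → ℝ, y = (∑ c, a c • dualPair (xg e εn 4) (xg e εn 5) (xg e εn 6) c) +
      ∑ c, b c • (xg e εn 3 * ![xg e εn 4, xg e εn 5, xg e εn 6] c) := by
  have h := xg_anti e εn
  rw [pow_two] at hy
  induction hy using Submodule.mul_induction_on' with
  | mem_mul_mem m hm n hn =>
    obtain ⟨a, s, rfl⟩ := mem_V e εn hspan hm
    obtain ⟨b, t, rfl⟩ := mem_V e εn hspan hn
    refine ⟨![a 1 * b 2 - a 2 * b 1, a 2 * b 0 - a 0 * b 2, a 0 * b 1 - a 1 * b 0],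
      fun i => s * b i - t * a i, ?_⟩
    simp [dualPair, Fin.sum_univ_three, mul_add, add_mul, h.swap, h.2]
    module
  | add x _ y _ hx hy =>
    obtain ⟨a, s, rfl⟩ := hx
    obtain ⟨b, t, rfl⟩ := hy
    refine ⟨a + b, s + t, ?_⟩
    simp only [Pi.add_apply, add_smul, Finset.sum_add_distrib]
    abel

theorem mem_11 (e : (Fin 3 → ℝ) →ₗ[ℝ] V) (εn : V)
    (hspan : Submodule.span ℝ
      (Set.range (Fin.snoc (fun i : Fin 3 => e (Pi.single i 1)) εn : Fin 4 → V)) = ⊤)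
    {y : BExt V} (hy : y ∈ Omeg V 1 1) : ∃ R r, y = mk11 (xg e εn) R r := by
  rw [Omeg, pow_one, pow_one] at hy
  induction hy using Submodule.mul_induction_on' with
  | mem_mul_mem m hm n hn =>
    obtain ⟨a, rfl⟩ := mem_W e εn hm
    obtain ⟨b, t, rfl⟩ := mem_V e εn hspan hn
    refine ⟨fun i j => a i * b j, fun i => a i * t, ?_⟩
    simp [mk11, Fin.sum_univ_three, mul_add, add_mul]
    module
  | add x _ y _ hx hy =>
    obtain ⟨a, s, rfl⟩ := hx
    obtain ⟨b, t, rfl⟩ := hy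
    exact ⟨_, _, mk11_add _ _ _ _⟩

theorem mem_12 (e : (Fin 3 → ℝ) →ₗ[ℝ] V) (εn : V)
    (hspan : Submodule.span ℝ
      (Set.range (Fin.snoc (fun i : Fin 3 => e (Pi.single i 1)) εn : Fin 4 → V)) = ⊤)
    {y : BExt V} (hy : y ∈ Omeg V 1 2) : ∃ S U, y = mk12 (xg e εn) S U := by
  rw [Omeg, pow_one] at hy
  induction hy using Submodule.mul_induction_on' with
  | mem_mul_mem m hm n hn =>
    obtain ⟨a, rfl⟩ := mem_W e εn hm
    obtain ⟨b, t, rfl⟩ := mem_VV e εn hspan hn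
    refine ⟨fun i j => a i * b j, fun i j => a i * t j, ?_⟩
    simp [mk12, Fin.sum_univ_three, mul_add, add_mul]
    module
  | add x _ y _ hx hy =>
    obtain ⟨a, s, rfl⟩ := hx
    obtain ⟨b, t, rfl⟩ := hy
    exact ⟨_, _, mk12_add _ _ _ _⟩

theorem mem_22 (e : (Fin 3 → ℝ) →ₗ[ℝ] V) (εn : V)
    (hspan : Submodule.span ℝ
      (Set.range (Fin.snoc (fun i : Fin 3 => e (Pi.single i 1)) εn : Fin 4 → V)) = ⊤)
    {y : BExt V} (hy : y ∈ Omeg V 2 2) : ∃ P Q, y = mk22 (xg e εn) P Q := by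
  rw [Omeg] at hy
  induction hy using Submodule.mul_induction_on' with
  | mem_mul_mem m hm n hn =>
    obtain ⟨a, rfl⟩ := mem_WW e εn hm
    obtain ⟨b, t, rfl⟩ := mem_VV e εn hspan hn
    refine ⟨fun i j => a i * b j, fun i j => a i * t j, ?_⟩
    simp [mk22, Fin.sum_univ_three, mul_add, add_mul]
    module
  | add x _ y _ hx hy =>
    obtain ⟨a, s, rfl⟩ := hx
    obtain ⟨b, t, rfl⟩ := hy
    exact ⟨_, _, mk22_add _ _ _ _⟩

theorem xg_W (e : (Fin 3 → ℝ) →ₗ[ℝ] V) (εn : V) (i : Fin 3) :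
    ![xg e εn 0, xg e εn 1, xg e εn 2] i ∈ LinearMap.range
      ((ExteriorAlgebra.ι ℝ).comp (LinearMap.inl ℝ (Fin 3 → ℝ) V)) := by
  refine ⟨Pi.single i 1, ?_⟩
  fin_cases i <;> simp [xg, gen]

theorem xg_V (e : (Fin 3 → ℝ) →ₗ[ℝ] V) (εn : V) (i : Fin 3) :
    ![xg e εn 4, xg e εn 5, xg e εn 6] i ∈ LinearMap.range
      ((ExteriorAlgebra.ι ℝ).comp (LinearMap.inr ℝ (Fin 3 → ℝ) V)) := by
  refine ⟨e (Pi.single i 1), ?_⟩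
  fin_cases i <;> simp [xg, gen]

theorem xg_n (e : (Fin 3 → ℝ) →ₗ[ℝ] V) (εn : V) :
    xg e εn 3 ∈ LinearMap.range
      ((ExteriorAlgebra.ι ℝ).comp (LinearMap.inr ℝ (Fin 3 → ℝ) V)) := by
  refine ⟨εn, ?_⟩
  simp [xg, gen]

theorem mk11_mem (e : (Fin 3 → ℝ) →ₗ[ℝ] V) (εn : V) (R : Fin 3 → Fin 3 → ℝ) (r : Fin 3 → ℝ) :
    mk11 (xg e εn) R r ∈ Omeg V 1 1 := by
  rw [Omeg, pow_one, pow_one, mk11]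
  refine add_mem (sum_mem fun i _ => sum_mem fun b _ => Submodule.smul_mem _ _ ?_)
    (sum_mem fun i _ => Submodule.smul_mem _ _ ?_)
  · exact Submodule.mul_mem_mul (xg_W e εn i) (xg_V e εn b)
  · exact Submodule.mul_mem_mul (xg_W e εn i) (xg_n e εn)

theorem mk12_mem (e : (Fin 3 → ℝ) →ₗ[ℝ] V) (εn : V) (S : Fin 3 → Fin 3 → ℝ) :
    mk12 (xg e εn) S 0 ∈ Omeg V 1 2 := by
  rw [Omeg, pow_one, pow_two, mk12]
  have v0 := xg_V e εn 0
  have v1 := xg_V e εn 1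
  have v2 := xg_V e εn 2
  refine add_mem (sum_mem fun i _ => sum_mem fun b _ => Submodule.smul_mem _ _ ?_) (by simp)
  refine Submodule.mul_mem_mul (xg_W e εn i) ?_
  fin_cases b
  · exact Submodule.mul_mem_mul v1 v2
  · exact Submodule.mul_mem_mul v2 v0
  · exact Submodule.mul_mem_mul v0 v1

/-- the pulled back metric -/
def gram (η : V →ₗ[ℝ] V →ₗ[ℝ] ℝ) (e : (Fin 3 → ℝ) →ₗ[ℝ] V) : Fin 3 → Fin 3 → ℝ :=
  fun i j => η (e (Pi.single i 1)) (e (Pi.single j 1))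

theorem brE_mk12 (η : V →ₗ[ℝ] V →ₗ[ℝ] ℝ) (e : (Fin 3 → ℝ) →ₗ[ℝ] V) (εn : V)
    (S : Fin 3 → Fin 3 → ℝ) :
    ιV εn * brE η e (mk12 (xg e εn) S 0) = mk22 (xg e εn) 0 (mixCof (gram η e) S) := by
  rw [← bracket_mk12 (xg_anti e εn) (gram η e) S _
    (fun j : Fin 3 => contrD ((η (e (Pi.single j 1))).comp (LinearMap.snd ℝ (Fin 3 → ℝ) V)))
    (fun j => xg_contr e εn _)]
  · simp only [brE, Fin.sum_univ_three]; rfl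
  all_goals intro j; simp [gen, gram]

theorem gram_det (η : V →ₗ[ℝ] V →ₗ[ℝ] ℝ) (e : (Fin 3 → ℝ) →ₗ[ℝ] V)
    (hsymm : ∀ v w : V, η v w = η w v)
    (hpull : ∀ w : Fin 3 → ℝ, (∀ w' : Fin 3 → ℝ, η (e w) (e w') = 0) → w = 0) :
    det3 (gram η e) ≠ 0 := by
  intro h0
  obtain ⟨w, hw, hw0⟩ := Matrix.exists_mulVec_eq_zero_iff.2 h0
  have dec : ∀ u : Fin 3 → ℝ, u = ∑ i, u i • (Pi.single i 1 : Fin 3 → ℝ) := fun u => by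
    ext j; simp [Finset.sum_apply, Pi.single_apply]
  refine hw (hpull w fun w' => ?_)
  have h1 : ∀ i, η (e w) (e (Pi.single i 1)) = 0 := fun i => by
    have h2 := congrFun hw0 i
    rw [hsymm, dec w]
    simpa [Matrix.mulVec, dotProduct, gram, mul_comm] using h2
  rw [dec w']
  simp [h1]

end concrete

theorem cofOne_zero {U : Fin 3 → Fin 3 → ℝ} (h : ∀ c d, cofOne U c d = 0) : U = 0 := by
  have a0 := h 0 0
  have a1 := h 1 1
  have a2 := h 2 2
  simp only [cofOne, trc, if_true] at a0 a1 a2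
  funext i j
  have := h j i
  simp only [cofOne, trc] at this
  split_ifs at this with hij
  · subst hij
    simp only [Pi.zero_apply]
    linarith
  · simp only [Pi.zero_apply]
    linarith

/-- **splitting of (2,2)-forms.** Let `V` be 4-dimensional with a
Lorentzian metric `η` whose pullback along the injective coframe `e : ℝ³ → V` is
nondegenerate, and let `ε_n` complete the image of `e` to a basis.  For every
`β ∈ Λ²(ℝ³)* ⊗ Λ²V` there exist a unique `v ∈ Ker(W₁^{∂(1,2)})` (i.e. `e ∧ v = 0`) and a
unique `ρ ∈ Λ¹(ℝ³)* ⊗ V` such that `β = e ∧ ρ + ε_n ∧ [e, v]`. -/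
theorem splitting_of_two_two_forms
    {V : Type*} [AddCommGroup V] [Module ℝ V]
    (hV : Module.finrank ℝ V = 4)
    (e : (Fin 3 → ℝ) →ₗ[ℝ] V) (εn : V)
    (hindep : LinearIndependent ℝ
      (Fin.snoc (fun i : Fin 3 => e (Pi.single i 1)) εn : Fin 4 → V))
    (hspan : Submodule.span ℝ
      (Set.range (Fin.snoc (fun i : Fin 3 => e (Pi.single i 1)) εn : Fin 4 → V)) = ⊤)
    (η : V →ₗ[ℝ] V →ₗ[ℝ] ℝ)
    (hsymm : ∀ v w : V, η v w = η w v)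
    (hnondeg : ∀ v : V, (∀ w : V, η v w = 0) → v = 0)
    (hpull : ∀ w : Fin 3 → ℝ, (∀ w' : Fin 3 → ℝ, η (e w) (e w') = 0) → w = 0) :
    ∀ β ∈ Omeg V 2 2,
      ∃! p : BExt V × BExt V,
        (p.1 ∈ Omeg V 1 2 ∧ Eelt e * p.1 = 0) ∧ p.2 ∈ Omeg V 1 1 ∧
          β = Eelt e * p.2 + ιV εn * brE η e p.1 := by
  intro β hβ
  obtain ⟨D, hD⟩ := exists_dual e εn hindep hspan
  have ha := xg_anti e εn
  have hg : ∀ i j, gram η e i j = gram η e j i := fun i j => hsymm _ _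
  have hdet := gram_det η e hsymm hpull
  obtain ⟨P, Q, rfl⟩ := mem_22 e εn hspan hβ
  -- the coordinates of an element of the kernel
  have kerc : ∀ y ∈ Omeg V 1 2, Eelt e * y = 0 →
      ∃ S : Fin 3 → Fin 3 → ℝ, (∀ i j, S i j = S j i) ∧ y = mk12 (xg e εn) S 0 := by
    intro y hy hy0
    obtain ⟨S, U, rfl⟩ := mem_12 e εn hspan hy
    rw [Eelt_eq e εn, eel_mk12 ha] at hy0
    obtain ⟨hX, hY⟩ := mk23_zero D hD _ _ hy0
    have hU := cofOne_zero hY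
    subst hU
    refine ⟨S, ?_, rfl⟩
    have s0 := hX 0
    have s1 := hX 1
    have s2 := hX 2
    simp only [Matrix.cons_val] at s0 s1 s2
    intro i j
    fin_cases i <;> fin_cases j <;> simp <;> linarith
  have eqn : ∀ (S R : Fin 3 → Fin 3 → ℝ) (r : Fin 3 → ℝ),
      Eelt e * mk11 (xg e εn) R r + ιV εn * brE η e (mk12 (xg e εn) S 0) =
        mk22 (xg e εn) (fun c d => - cofOne R c d) (skewM r + mixCof (gram η e) S) := by
    intro S R r
    rw [Eelt_eq e εn, eel_mk11 ha, brE_mk12, mk22_add, add_zero]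
  -- the explicit solution
  let T : Fin 3 → Fin 3 → ℝ := fun c d => (Q c d + Q d c) / 2
  have hT : ∀ i j, T i j = T j i := fun i j => by simp only [T]; ring
  let S₀ : Fin 3 → Fin 3 → ℝ := fun i j => invCof (gram η e) T i j / det3 (gram η e)
  let R₀ : Fin 3 → Fin 3 → ℝ := fun i b => P b i - (if i = b then trc P / 2 else 0)
  let r₀ : Fin 3 → ℝ :=
    ![(Q 1 2 - Q 2 1) / 2, (Q 2 0 - Q 0 2) / 2, (Q 0 1 - Q 1 0) / 2]
  have hS₀ : ∀ i j, S₀ i j = S₀ j i := fun i j => by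
    simp only [S₀]; rw [invCof_symm _ _ hg hT]
  have hmix : ∀ i j, mixCof (gram η e) S₀ i j = T i j := fun i j => by
    have h1 := mixCof_invCof (gram η e) T hg hT i j
    have h2 : mixCof (gram η e) S₀ i j =
        mixCof (gram η e) (invCof (gram η e) T) i j / det3 (gram η e) := by
      simp only [mixCof, S₀]; ring
    rw [h2, h1]; field_simp
  refine ⟨(mk12 (xg e εn) S₀ 0, mk11 (xg e εn) R₀ r₀),
    ⟨⟨mk12_mem e εn S₀, ?_⟩, mk11_mem e εn R₀ r₀, ?_⟩, ?_⟩
  · rw [Eelt_eq e εn, eel_mk12 ha, hS₀ 1 2, hS₀ 2 0, hS₀ 0 1]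
    simp [mk23, cofOne, trc, Fin.sum_univ_three]
  · rw [eqn]
    congr 1
    · funext c d
      fin_cases c <;> fin_cases d <;> simp [cofOne, R₀, trc] <;> ring
    · funext c d
      rw [Pi.add_apply, Pi.add_apply, hmix]
      fin_cases c <;> fin_cases d <;> simp [skewM, r₀, T] <;> ring
  · rintro ⟨v, ρ⟩ ⟨⟨hv, hv0⟩, hρ, heq⟩
    obtain ⟨S, hS, hvS⟩ := kerc v hv hv0
    obtain ⟨R, r, hρR⟩ := mem_11 e εn hspan hρ
    simp only at hvS hρR heq
    subst hvS hρR
    rw [eqn, ← sub_eq_zero, mk22_sub] at heq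
    obtain ⟨hP, hQ⟩ := mk22_zero D hD _ _ heq
    simp only [Pi.sub_apply, Pi.add_apply] at hP hQ
    have hM := mixCof_symm (gram η e) S hg hS
    have hTS : T = mixCof (gram η e) S := by
      funext c d
      have h1 := hQ c d
      have h2 := hQ d c
      have h3 := hM c d
      have h4 : skewM r c d + skewM r d c = 0 := by
        fin_cases c <;> fin_cases d <;> simp [skewM]
      simp only [T]
      linarith
    have eS : S = S₀ := by
      funext i j
      simp only [S₀]
      rw [hTS, invCof_mixCof _ _ hg hS]
      field_simp
    have er : r = r₀ := by
      have q1 := hQ 1 2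
      have q2 := hQ 2 1
      have q3 := hQ 2 0
      have q4 := hQ 0 2
      have q5 := hQ 0 1
      have q6 := hQ 1 0
      rw [hM 2 1] at q2
      rw [hM 2 0] at q3
      rw [hM 1 0] at q6
      simp only [skewM, Matrix.cons_val] at q1 q2 q3 q4 q5 q6
      funext i
      fin_cases i <;> simp [r₀] <;> linarith
    have eR : R = R₀ := by
      have p0 := hP 0 0
      have p1 := hP 1 1
      have p2 := hP 2 2
      simp only [cofOne, trc, if_true] at p0 p1 p2
      funext i j
      have := hP j i
      simp only [cofOne, trc] at this
      simp only [R₀, trc]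
      by_cases hij : i = j
      · subst hij
        simp only [if_true] at this ⊢
        linarith
      · rw [if_neg (Ne.symm hij)] at this
        rw [if_neg hij]
        linarith
    rw [eS, er, eR]
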